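/- Let X and Y be independent centered Gaussian random variables with positive variances. Then for all positive integers m, n, r, E[X^{2m} Y^{2n} (X+Y)^{2r}] ≥ binom½((m ∧ n) + r, r) · E[X^{2m}] · E[Y^{2n}] · E[(X+Y)^{2r}], where m ∧ n denotes min(m, n). -/

import Mathlib

open MeasureTheory ProbabilityTheory
open scoped NNReal

/-- `oddDoubleFactorial n = (2n - 1)!! = 1 * 3 * ⋯ * (2n - 1)`, with `(-1)!! = 1`. -/
def oddDoubleFactorial (n : ℕ) : ℕ := ∏ k ∈ Finset.range n, (2 * k + 1)

/-- The half-binomial coefficient `binom½(n, k) = (2n-1)!! / ((2n-2k-1)!! (2k-1)!!)`. -/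
noncomputable def halfBinom (n k : ℕ) : ℝ :=
  (oddDoubleFactorial n : ℝ) /
    ((oddDoubleFactorial (n - k) : ℝ) * (oddDoubleFactorial k : ℝ))

lemma oddDoubleFactorial_zero : oddDoubleFactorial 0 = 1 := rfl

lemma oddDoubleFactorial_succ (n : ℕ) :
    oddDoubleFactorial (n + 1) = oddDoubleFactorial n * (2 * n + 1) :=
  Finset.prod_range_succ _ _

lemma oddDoubleFactorial_pos (n : ℕ) : 0 < oddDoubleFactorial n :=
  Finset.prod_pos fun _ _ => by positivity

lemma oddDoubleFactorial_add_add_mul_le (p j k : ℕ) :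
    oddDoubleFactorial (p + (j + k)) * oddDoubleFactorial p *
        (oddDoubleFactorial j * oddDoubleFactorial k) ≤
      oddDoubleFactorial (p + j) * oddDoubleFactorial (p + k) * oddDoubleFactorial (j + k) := by
  induction p with
  | zero => exact le_of_eq (by simp only [zero_add, oddDoubleFactorial_zero]; ring)
  | succ p ih =>
    have factors : (2 * (p + (j + k)) + 1) * (2 * p + 1) ≤
        (2 * (p + j) + 1) * (2 * (p + k) + 1) := by
      nlinarith [Nat.zero_le (j * k)]
    have product := Nat.mul_le_mul ih factors
    simp only [Nat.add_right_comm p 1, oddDoubleFactorial_succ]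
    linarith

lemma oddDoubleFactorial_add_mul_le_of_le {p m : ℕ} (hpm : p ≤ m) (j : ℕ) :
    oddDoubleFactorial (p + j) * oddDoubleFactorial m ≤
      oddDoubleFactorial (m + j) * oddDoubleFactorial p := by
  induction m, hpm using Nat.le_induction with
  | base => exact le_rfl
  | succ m _ ih =>
    have product := Nat.mul_le_mul ih (show 2 * m + 1 ≤ 2 * (m + j) + 1 by omega)
    simp only [Nat.add_right_comm m 1, oddDoubleFactorial_succ]
    linarith

lemma halfBinom_mul_oddDoubleFactorial_le (m n j k : ℕ) :
    halfBinom (min m n + (j + k)) (j + k) *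
        ((oddDoubleFactorial m : ℝ) * oddDoubleFactorial n *
          (oddDoubleFactorial j * oddDoubleFactorial k)) ≤
      oddDoubleFactorial (m + j) * oddDoubleFactorial (n + k) := by
  set p := min m n
  have key := oddDoubleFactorial_add_add_mul_le p j k
  have hm := oddDoubleFactorial_add_mul_le_of_le (min_le_left m n) j
  have hn := oddDoubleFactorial_add_mul_le_of_le (min_le_right m n) k
  have hp := oddDoubleFactorial_pos p
  have hr := oddDoubleFactorial_pos (j + k)
  have bound : oddDoubleFactorial (p + (j + k)) *
      (oddDoubleFactorial m * oddDoubleFactorial n *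
        (oddDoubleFactorial j * oddDoubleFactorial k)) ≤
      oddDoubleFactorial (m + j) * oddDoubleFactorial (n + k) *
        (oddDoubleFactorial p * oddDoubleFactorial (j + k)) := by
    refine Nat.le_of_mul_le_mul_right (c := oddDoubleFactorial p) ?_ hp
    have h₁ := Nat.mul_le_mul_right (oddDoubleFactorial m * oddDoubleFactorial n) key
    have h₂ := Nat.mul_le_mul_right (oddDoubleFactorial (j + k)) (Nat.mul_le_mul hm hn)
    linarith
  rw [halfBinom, Nat.add_sub_cancel, div_mul_eq_mul_div, div_le_iff₀ (by positivity)]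
  exact_mod_cast bound

lemma integral_even_pow_gaussianReal_eq_integral_Ioi {v : ℝ≥0} (hv : v ≠ 0) (n : ℕ) :
    ∫ x, x ^ (2 * n) ∂gaussianReal 0 v =
      (√(2 * Real.pi * v))⁻¹ * ((1 / (2 * v : ℝ)) ^ (-((2 * n : ℕ) + 1 : ℝ) / 2) *
        Real.Gamma (((2 * n : ℕ) + 1 : ℝ) / 2)) := by
  have hv₀ : (0 : ℝ) < v := by positivity
  have half_line := integral_rpow_mul_exp_neg_mul_rpow (p := 2) (q := (2 * n : ℕ))
    (b := 1 / (2 * v : ℝ)) (by norm_num) (by linarith [Nat.cast_nonneg (α := ℝ) (2 * n)])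
    (by positivity)
  simp only [Real.rpow_natCast, Real.rpow_two] at half_line
  have fold := integral_comp_abs (f := fun x : ℝ => x ^ (2 * n) * Real.exp (-(1 / (2 * v)) * x ^ 2))
  rw [half_line] at fold
  simp only [(even_two_mul n).pow_abs, sq_abs] at fold
  rw [integral_gaussianReal_eq_integral_smul hv]
  have density : ∀ x : ℝ, gaussianPDFReal 0 v x • x ^ (2 * n) =
      (√(2 * Real.pi * v))⁻¹ * (x ^ (2 * n) * Real.exp (-(1 / (2 * v)) * x ^ 2)) := by
    intro x
    rw [gaussianPDFReal, smul_eq_mul, sub_zero,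
      show -x ^ 2 / (2 * (v : ℝ)) = -(1 / (2 * v)) * x ^ 2 by ring]
    ring
  simp only [density]
  rw [integral_const_mul, fold]
  ring

lemma integral_even_pow_gaussianReal {v : ℝ≥0} (hv : v ≠ 0) (n : ℕ) :
    ∫ x, x ^ (2 * n) ∂gaussianReal 0 v = (v : ℝ) ^ n * oddDoubleFactorial n := by
  induction n with
  | zero => simp [oddDoubleFactorial_zero]
  | succ n ih =>
    have hv₀ : (0 : ℝ) < v := by positivity
    rw [integral_even_pow_gaussianReal_eq_integral_Ioi hv] at ih ⊢
    have exponent : -((2 * (n + 1) : ℕ) + 1 : ℝ) / 2 = -((2 * n : ℕ) + 1 : ℝ) / 2 - 1 := by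
      push_cast; ring
    have argument : ((2 * (n + 1) : ℕ) + 1 : ℝ) / 2 = ((2 * n : ℕ) + 1 : ℝ) / 2 + 1 := by
      push_cast; ring
    rw [exponent, argument, Real.Gamma_add_one (by positivity),
      Real.rpow_sub_one (by positivity), oddDoubleFactorial_succ, pow_succ]
    calc _ = (√(2 * Real.pi * v))⁻¹ * ((1 / (2 * v : ℝ)) ^ (-((2 * n : ℕ) + 1 : ℝ) / 2) *
            Real.Gamma (((2 * n : ℕ) + 1 : ℝ) / 2)) * (v * (2 * n + 1)) := by
          push_cast; field_simp
      _ = _ := by rw [ih]; push_cast; ring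

lemma integral_odd_pow_gaussianReal (v : ℝ≥0) {n : ℕ} (hn : Odd n) :
    ∫ x, x ^ n ∂gaussianReal 0 v = 0 := by
  have reflect : ∫ x, x ^ n ∂gaussianReal 0 v = ∫ x, (-x) ^ n ∂gaussianReal 0 v := by
    conv_lhs => rw [← neg_zero, ← gaussianReal_map_neg]
    exact integral_map (by fun_prop) (by fun_prop)
  simp only [hn.neg_pow, integral_neg] at reflect
  linarith

lemma integrable_pow_gaussianReal (μ : ℝ) (v : ℝ≥0) (n : ℕ) :
    Integrable (fun x => x ^ n) (gaussianReal μ v) := by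
  have moment := (memLp_id_gaussianReal (μ := μ) (v := v) n).integrable_norm_pow'
  refine (integrable_norm_iff (by fun_prop)).1 ?_
  simpa [norm_pow] using moment

lemma integral_pow_mul_pow_mul_add_pow {Ω : Type*} [MeasurableSpace Ω] {P : Measure Ω}
    {X Y : Ω → ℝ} (hX : ∀ n : ℕ, Integrable (fun ω => X ω ^ n) P)
    (hY : ∀ n : ℕ, Integrable (fun ω => Y ω ^ n) P) (hindep : IndepFun X Y P) (p q s : ℕ) :
    ∫ ω, X ω ^ p * Y ω ^ q * (X ω + Y ω) ^ s ∂P =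
      ∑ i ∈ Finset.range (s + 1),
        (s.choose i : ℝ) * ((∫ ω, X ω ^ (p + i) ∂P) * ∫ ω, Y ω ^ (q + (s - i)) ∂P) := by
  have indep_pow (a b : ℕ) : IndepFun (fun ω => X ω ^ a) (fun ω => Y ω ^ b) P :=
    hindep.comp (φ := fun x : ℝ => x ^ a) (ψ := fun x : ℝ => x ^ b) (by fun_prop) (by fun_prop)
  have expand : ∀ ω, X ω ^ p * Y ω ^ q * (X ω + Y ω) ^ s =
      ∑ i ∈ Finset.range (s + 1),
        (s.choose i : ℝ) * (X ω ^ (p + i) * Y ω ^ (q + (s - i))) := by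
    intro ω
    rw [add_pow, Finset.mul_sum]
    refine Finset.sum_congr rfl fun i _ => ?_
    ring
  have integrable_pow_mul (a b : ℕ) : Integrable (fun ω => X ω ^ a * Y ω ^ b) P :=
    (indep_pow a b).integrable_mul (hX a) (hY b)
  simp only [expand]
  rw [integral_finsetSum _ fun i _ => (integrable_pow_mul _ _).const_mul _]
  refine Finset.sum_congr rfl fun i _ => ?_
  rw [integral_const_mul, (indep_pow _ _).integral_fun_mul_eq_mul_integral
    (hX _).aestronglyMeasurable (hY _).aestronglyMeasurable]

/-- For independent centered Gaussian `X, Y` with positive variances and positive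
integers `m, n, r`:
`E[X^{2m} Y^{2n} (X+Y)^{2r}] ≥ binom½(min m n + r, r) E[X^{2m}] E[Y^{2n}] E[(X+Y)^{2r}]`. -/
theorem gaussian_product_inequality_sum_improved
    {Ω : Type*} [MeasurableSpace Ω] (P : Measure Ω) [IsProbabilityMeasure P]
    (X Y : Ω → ℝ) (vX vY : ℝ≥0) (hvX : 0 < vX) (hvY : 0 < vY)
    (hX : Measure.map X P = gaussianReal 0 vX)
    (hY : Measure.map Y P = gaussianReal 0 vY)
    (hindep : IndepFun X Y P)
    (m n r : ℕ) (hm : 0 < m) (hn : 0 < n) (hr : 0 < r) :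
    (∫ ω, (X ω) ^ (2 * m) * (Y ω) ^ (2 * n) * (X ω + Y ω) ^ (2 * r) ∂P)
      ≥ halfBinom (min m n + r) r *
          ((∫ ω, (X ω) ^ (2 * m) ∂P) * (∫ ω, (Y ω) ^ (2 * n) ∂P)
            * (∫ ω, (X ω + Y ω) ^ (2 * r) ∂P)) := by
  have measurable_of_law {Z : Ω → ℝ} {v : ℝ≥0} (hZ : Measure.map Z P = gaussianReal 0 v) :
      AEMeasurable Z P :=
    AEMeasurable.of_map_ne_zero (by rw [hZ]; exact IsProbabilityMeasure.ne_zero _)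
  have integrable_of_law {Z : Ω → ℝ} {v : ℝ≥0} (hZ : Measure.map Z P = gaussianReal 0 v)
      (k : ℕ) : Integrable (fun ω => Z ω ^ k) P :=
    (integrable_map_measure (g := fun x : ℝ => x ^ k) (by fun_prop) (measurable_of_law hZ)).1
      (by rw [hZ]; exact integrable_pow_gaussianReal 0 v k)
  have moment_of_law {Z : Ω → ℝ} {v : ℝ≥0} (hZ : Measure.map Z P = gaussianReal 0 v)
      (k : ℕ) : ∫ ω, Z ω ^ k ∂P = ∫ x, x ^ k ∂gaussianReal 0 v := by
    rw [← hZ, integral_map (measurable_of_law hZ) (by fun_prop)]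
  have sum_moment := integral_pow_mul_pow_mul_add_pow (integrable_of_law hX)
    (integrable_of_law hY) hindep 0 0 (2 * r)
  simp only [pow_zero, one_mul, zero_add] at sum_moment
  rw [sum_moment, integral_pow_mul_pow_mul_add_pow (integrable_of_law hX)
    (integrable_of_law hY) hindep, Finset.mul_sum, Finset.mul_sum, ge_iff_le]
  simp only [moment_of_law hX, moment_of_law hY]
  refine Finset.sum_le_sum fun i hi => ?_
  rcases Nat.even_or_odd' i with ⟨j, rfl | rfl⟩
  · obtain ⟨k, rfl⟩ : ∃ k, r = j + k :=
      Nat.exists_eq_add_of_le (by have := Finset.mem_range.1 hi; omega)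
    rw [show 2 * (j + k) - 2 * j = 2 * k by omega, ← Nat.mul_add 2 m j, ← Nat.mul_add 2 n k]
    simp only [integral_even_pow_gaussianReal hvX.ne', integral_even_pow_gaussianReal hvY.ne']
    have scaled := mul_le_mul_of_nonneg_left (halfBinom_mul_oddDoubleFactorial_le m n j k)
      (show (0 : ℝ) ≤ ((2 * (j + k)).choose (2 * j) : ℝ) *
        ((vX : ℝ) ^ (m + j) * (vY : ℝ) ^ (n + k)) by positivity)
    simp only [pow_add] at scaled ⊢
    linarith
  · have odd_shift : Odd (2 * m + (2 * j + 1)) := ⟨m + j, by ring⟩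
    simp [integral_odd_pow_gaussianReal vX odd_shift,
      integral_odd_pow_gaussianReal vX (odd_two_mul_add_one j)]
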